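/- arXiv:1504.00564 — 4 statements merged into one kernel-verified Lean document; each statement's English description precedes it below -/
import Mathlib

section
/- Let n ≥ 1 be an integer, let Q ⊂ ℝⁿ be an open cube of side length ζ > 0, let A ⊆ Q be a Lebesgue measurable set, and let f : Q → ℝ be a C¹ function such that for some coordinate index i and some constant c > 0 one has |∂f/∂x_i(x)| ≥ c for all x ∈ Q. Then for every α ≥ 0 the Lebesgue measure of the set {x ∈ A : |f(x)| ≤ α} is at most 2 ζ^{n−1} α c^{−1}. -/
open MeasureTheory

/-- A real function whose derivative has absolute value at least `c > 0` on an open interval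
takes values in `[-α, α]` on a set of measure at most `2 α c⁻¹`. -/
lemma volume_abs_le_of_le_abs_deriv {g g' : ℝ → ℝ} {u v c α : ℝ} (hc : 0 < c)
    (hg : ∀ t ∈ Set.Ioo u v, HasDerivAt g (g' t) t)
    (hg' : ∀ t ∈ Set.Ioo u v, c ≤ |g' t|) :
    volume {t ∈ Set.Ioo u v | |g t| ≤ α} ≤ ENNReal.ofReal (2 * α * c⁻¹) := by
  have key : ∀ s ∈ Set.Ioo u v, ∀ t ∈ Set.Ioo u v, |g s| ≤ α → |g t| ≤ α → s < t →
      t - s ≤ 2 * α * c⁻¹ := by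
    intro s hs t ht hgs hgt hst
    have hsub : Set.Icc s t ⊆ Set.Ioo u v := Set.Icc_subset_Ioo hs.1 ht.2
    obtain ⟨r, hr, hslope⟩ := exists_hasDerivAt_eq_slope g g' hst
      (fun r hr => (hg r (hsub hr)).continuousAt.continuousWithinAt)
      (fun r hr => hg r (hsub (Set.Ioo_subset_Icc_self hr)))
    have hcr := hg' r (hsub (Set.Ioo_subset_Icc_self hr))
    have hpos : 0 < t - s := sub_pos.2 hst
    rw [hslope, abs_div, abs_of_pos hpos, le_div_iff₀ hpos] at hcr
    rw [← div_eq_mul_inv, le_div_iff₀ hc]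
    linarith [abs_sub (g t) (g s)]
  refine (Real.volume_le_diam _).trans (Metric.ediam_le fun s hs t ht => ?_)
  rw [edist_dist, Real.dist_eq]
  rcases lt_trichotomy s t with h | rfl | h
  · rw [abs_sub_comm, abs_of_pos (sub_pos.2 h)]
    exact ENNReal.ofReal_le_ofReal (key s hs.1 t ht.1 hs.2 ht.2 h)
  · simp
  · rw [abs_of_pos (sub_pos.2 h)]
    exact ENNReal.ofReal_le_ofReal (key t ht.1 s hs.1 ht.2 hs.2 h)

/-- One-derivative measure estimate: if `f` is `C¹` on an open cube `Q` of side
`ζ` and some partial derivative `∂f/∂x_i` has absolute value at least `c > 0` throughout `Q`,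
then for any measurable `A ⊆ Q` and any `α ≥ 0` the set `{x ∈ A : |f x| ≤ α}` has Lebesgue
measure at most `2 ζ^(n-1) α c⁻¹`. -/
theorem small_divisor_measure_estimate_first_order
    (n : ℕ) (hn : 1 ≤ n) (ζ : ℝ) (hζ : 0 < ζ) (a : Fin n → ℝ)
    (A : Set (Fin n → ℝ)) (hA : MeasurableSet A)
    (hAQ : A ⊆ Set.univ.pi fun i => Set.Ioo (a i) (a i + ζ))
    (f : (Fin n → ℝ) → ℝ)
    (hf : ContDiffOn ℝ 1 f (Set.univ.pi fun i => Set.Ioo (a i) (a i + ζ)))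
    (i : Fin n) (c : ℝ) (hc : 0 < c)
    (hderiv : ∀ x ∈ Set.univ.pi fun i => Set.Ioo (a i) (a i + ζ),
      c ≤ |fderiv ℝ f x (Pi.single i 1)|)
    (α : ℝ) (hα : 0 ≤ α) :
    volume {x ∈ A | |f x| ≤ α} ≤ ENNReal.ofReal (2 * ζ ^ (n - 1) * α * c⁻¹) := by
  obtain ⟨m, rfl⟩ : ∃ m, n = m + 1 := ⟨n - 1, by omega⟩
  set Q : Set (Fin (m + 1) → ℝ) := Set.univ.pi fun i => Set.Ioo (a i) (a i + ζ) with hQ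
  have hQo : IsOpen Q := isOpen_set_pi Set.finite_univ fun _ _ => isOpen_Ioo
  set S : Set (Fin (m + 1) → ℝ) := {x ∈ Q | |f x| ≤ α} with hS
  have hSm : MeasurableSet S := by
    have hSQ : S = Q \ (Q ∩ f ⁻¹' {y | α < |y|}) := by
      ext x
      simp only [hS, Set.mem_sdiff, Set.mem_inter_iff, Set.mem_preimage,
        Set.mem_ofPred_eq, not_and, not_lt]
      tauto
    rw [hSQ]
    exact hQo.measurableSet.diff (hf.continuousOn.isOpen_inter_preimage hQo
      (isOpen_lt continuous_const continuous_abs)).measurableSet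
  have hAS : {x ∈ A | |f x| ≤ α} ⊆ S := fun x hx => ⟨hAQ hx.1, hx.2⟩
  refine (measure_mono hAS).trans ?_
  set e := MeasurableEquiv.piFinSuccAbove (fun _ : Fin (m + 1) => ℝ) i
  have hmp := (volume_preserving_piFinSuccAbove (fun _ : Fin (m + 1) => ℝ) i).symm
  have he_symm : ∀ t y, e.symm (t, y) = i.insertNth t y := fun _ _ => rfl
  set Q' : Set (Fin m → ℝ) :=
    Set.univ.pi fun j => Set.Ioo (a (i.succAbove j)) (a (i.succAbove j) + ζ) with hQ'
  have hmem : ∀ (t : ℝ) (y : Fin m → ℝ), (i.insertNth t y : Fin (m + 1) → ℝ) ∈ Q ↔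
      t ∈ Set.Ioo (a i) (a i + ζ) ∧ y ∈ Q' := by
    intro t y
    simp only [hQ, hQ', Set.mem_univ_pi]
    rw [Fin.forall_iff_succAbove i]
    simp
  have hslice : ∀ y : Fin m → ℝ, volume ((fun t : ℝ => (t, y)) ⁻¹' (e.symm ⁻¹' S)) ≤
      Q'.indicator (fun _ => ENNReal.ofReal (2 * α * c⁻¹)) y := by
    intro y
    by_cases hy : y ∈ Q'
    · rw [Set.indicator_of_mem hy]
      have hset : (fun t : ℝ => (t, y)) ⁻¹' (e.symm ⁻¹' S) =
          {t ∈ Set.Ioo (a i) (a i + ζ) | |f (i.insertNth t y)| ≤ α} := by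
        ext t
        simp only [Set.mem_preimage, he_symm, hS, Set.mem_sep_iff, hmem, hy, and_true]
      rw [hset]
      refine volume_abs_le_of_le_abs_deriv
        (g' := fun t => fderiv ℝ f (i.insertNth t y) (Pi.single i 1)) hc (fun t ht => ?_)
        (fun t ht => hderiv _ ((hmem t y).2 ⟨ht, hy⟩))
      have hfd : HasFDerivAt f (fderiv ℝ f (i.insertNth t y)) (i.insertNth t y) :=
        ((hf.differentiableOn one_ne_zero).differentiableAt
          (hQo.mem_nhds ((hmem t y).2 ⟨ht, hy⟩))).hasFDerivAt
      have hins : HasDerivAt (fun t : ℝ => (i.insertNth t y : Fin (m + 1) → ℝ))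
          (Pi.single i 1) t := by
        refine hasDerivAt_pi.2 fun j => ?_
        refine Fin.succAboveCases i ?_ (fun k => ?_) j
        · simpa using hasDerivAt_id' t
        · simpa using hasDerivAt_const t (y k)
      exact hfd.comp_hasDerivAt t hins
    · have hset : (fun t : ℝ => (t, y)) ⁻¹' (e.symm ⁻¹' S) = ∅ := by
        ext t
        simp only [Set.mem_preimage, he_symm, hS, Set.mem_sep_iff, hmem, hy, and_false,
          false_and, Set.mem_empty_iff_false]
      simp [hset]
  have hQ'm : MeasurableSet Q' := MeasurableSet.univ_pi fun _ => measurableSet_Ioo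
  have hvol : volume Q' = ENNReal.ofReal (ζ ^ m) := by
    rw [hQ', volume_pi_pi]
    simp [ENNReal.ofReal_pow hζ.le]
  calc volume S = (volume.prod volume) (e.symm ⁻¹' S) :=
        (hmp.measure_preimage hSm.nullMeasurableSet).symm
    _ = ∫⁻ y, volume ((fun t : ℝ => (t, y)) ⁻¹' (e.symm ⁻¹' S)) :=
        Measure.prod_apply_symm (e.symm.measurable hSm)
    _ ≤ ∫⁻ y, Q'.indicator (fun _ => ENNReal.ofReal (2 * α * c⁻¹)) y := lintegral_mono hslice
    _ = ENNReal.ofReal (2 * ζ ^ (m + 1 - 1) * α * c⁻¹) := by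
        rw [lintegral_indicator_const hQ'm, hvol, ← ENNReal.ofReal_mul (by positivity)]
        congr 1
        rw [Nat.add_sub_cancel]
        ring
end

section
/- Let n ≥ 1 be an integer, let U ⊆ ℝⁿ be open, let O ⊆ U be Lebesgue measurable, and let ω : U → ℝⁿ be a C¹ diffeomorphism onto its image V. Assume that V is contained in a cube of side length ζ > 0 and that |det D(ω⁻¹)(y)| ≤ J for all y ∈ V. Then for every ν ∈ ℤⁿ with ν ≠ 0 and every δ ≥ 0, the Lebesgue measure of the set {ξ ∈ O : |ω(ξ)·ν| ≤ δ} is at most 2 J ζ^{n−1} δ / |ν|_∞, where |ν|_∞ = max_i |ν_i| and ω(ξ)·ν = Σ_i ω_i(ξ) ν_i. -/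
open MeasureTheory

/-- The slice `{t : |t * a + c| ≤ δ}` is an interval of length `2 * δ / |a|`. -/
theorem volume_abs_mul_add_le (a c δ : ℝ) (ha : a ≠ 0) :
    volume {t : ℝ | |t * a + c| ≤ δ} ≤ ENNReal.ofReal (2 * δ / |a|) := by
  have ha' : 0 < |a| := abs_pos.mpr ha
  have hsub : {t : ℝ | |t * a + c| ≤ δ} ⊆ Metric.closedBall (-c / a) (δ / |a|) := by
    intro t ht
    rw [Metric.mem_closedBall, Real.dist_eq, le_div_iff₀ ha', ← abs_mul]
    have : (t - -c / a) * a = t * a + c := by field_simp; ring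
    rwa [this]
  refine (measure_mono hsub).trans ?_
  rw [Real.volume_closedBall, mul_div_assoc]

/-- The part of a cube of side `ζ` lying in the strip `|y · v| ≤ δ` has volume at most
`ζ ^ m * (2 * δ / |v k|)`, for every coordinate `k` with `v k ≠ 0`. -/
theorem volume_cube_inter_strip_le (m : ℕ) (ζ : ℝ) (hζ : 0 ≤ ζ) (b v : Fin (m + 1) → ℝ)
    (k : Fin (m + 1)) (hk : v k ≠ 0) (δ : ℝ) :
    volume ((Set.univ.pi fun i => Set.Ioo (b i) (b i + ζ)) ∩ {y | |∑ i, y i * v i| ≤ δ}) ≤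
      ENNReal.ofReal (ζ ^ m * (2 * δ / |v k|)) := by
  set S : Set (Fin (m + 1) → ℝ) :=
    (Set.univ.pi fun i => Set.Ioo (b i) (b i + ζ)) ∩ {y | |∑ i, y i * v i| ≤ δ} with hS_def
  have hS : MeasurableSet S := by
    refine (MeasurableSet.univ_pi fun _ => measurableSet_Ioo).inter ?_
    exact measurableSet_le (by fun_prop) measurable_const
  let e := MeasurableEquiv.piFinSuccAbove (fun _ : Fin (m + 1) => ℝ) k
  have he : MeasurePreserving e.symm :=
    (volume_preserving_piFinSuccAbove (fun _ : Fin (m + 1) => ℝ) k).symm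
  rw [← he.measure_preimage_equiv, Measure.volume_eq_prod,
    Measure.prod_apply_symm (e.symm.measurable hS)]
  set C : Set (Fin m → ℝ) :=
    Set.univ.pi fun i => Set.Ioo (b (k.succAbove i)) (b (k.succAbove i) + ζ) with hC_def
  have hC : MeasurableSet C := MeasurableSet.univ_pi fun _ => measurableSet_Ioo
  calc ∫⁻ z, volume ((fun t => (t, z)) ⁻¹' (e.symm ⁻¹' S))
      ≤ ∫⁻ z, C.indicator (fun _ => ENNReal.ofReal (2 * δ / |v k|)) z := by
        refine lintegral_mono fun z => ?_
        by_cases hz : z ∈ C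
        · rw [Set.indicator_of_mem hz]
          refine (measure_mono ?_).trans
            (volume_abs_mul_add_le (v k) (∑ i, z i * v (k.succAbove i)) δ hk)
          intro t ht
          have h2 : |∑ i, (k.insertNth t z : Fin (m + 1) → ℝ) i * v i| ≤ δ := ht.2
          rw [Fin.sum_univ_succAbove _ k] at h2
          simpa using h2
        · rw [Set.indicator_of_notMem hz, nonpos_iff_eq_zero, ← measure_empty (μ := (volume : Measure ℝ))]
          congr 1
          refine Set.eq_empty_of_forall_notMem fun t ht => hz fun i _ => ?_
          have h1 : (k.insertNth t z : Fin (m + 1) → ℝ) (k.succAbove i) ∈ _ :=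
            ht.1 (k.succAbove i) trivial
          simpa using h1
    _ = ENNReal.ofReal (ζ ^ m * (2 * δ / |v k|)) := by
        rw [lintegral_indicator_const hC, hC_def, volume_pi_pi,
          ENNReal.ofReal_mul (pow_nonneg hζ m), mul_comm, ENNReal.ofReal_pow hζ]
        simp

/-- If `ω` is differentiable on an open set `U` and has a left inverse `g` that is differentiable
within `ω '' U`, then `ω '' U` is open. -/
theorem isOpen_image_of_differentiableOn_leftInverse {E : Type*} [NormedAddCommGroup E]
    [NormedSpace ℝ E] [FiniteDimensional ℝ E] {U : Set E} (hU : IsOpen U) {ω g : E → E}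
    (hω : ContDiffOn ℝ 1 ω U) (hg : DifferentiableOn ℝ g (ω '' U))
    (hinv : ∀ ξ ∈ U, g (ω ξ) = ξ) : IsOpen (ω '' U) := by
  have : CompleteSpace E := FiniteDimensional.complete ℝ E
  rw [isOpen_iff_mem_nhds]
  rintro _ ⟨ξ, hξ, rfl⟩
  have hUξ : U ∈ nhds ξ := hU.mem_nhds hξ
  have hωξ : HasStrictFDerivAt ω (fderiv ℝ ω ξ) ξ :=
    (hω.contDiffAt hUξ).hasStrictFDerivAt one_ne_zero
  have hcomp := (hg _ (Set.mem_image_of_mem ω hξ)).hasFDerivWithinAt.comp ξ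
    hωξ.hasFDerivAt.hasFDerivWithinAt (Set.mapsTo_image ω U)
  have hid : HasFDerivAt (g ∘ ω) (ContinuousLinearMap.id ℝ E) ξ :=
    (hasFDerivAt_id ξ).congr_of_eventuallyEq (Filter.eventually_of_mem hUξ hinv)
  have heq := (hcomp.hasFDerivAt hUξ).unique hid
  have hinj : Function.Injective (fderiv ℝ ω ξ : E →ₗ[ℝ] E) :=
    Function.LeftInverse.injective fun x => DFunLike.congr_fun heq x
  have hsurj : (fderiv ℝ ω ξ).range = ⊤ :=
    LinearMap.range_eq_top.mpr (LinearMap.injective_iff_surjective.mp hinj)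
  rw [← hωξ.map_nhds_eq_of_surj hsurj]
  exact Filter.image_mem_map hUξ

/-- Measure estimate for the first Melnikov resonant set: if `ω : U → ℝⁿ` is a
`C¹` diffeomorphism onto its image `V = ω '' U`, `V` is contained in a cube of side `ζ`, and the
Jacobian determinant of the inverse is bounded by `J` on `V`, then for every `ν ∈ ℤⁿ ∖ {0}` and
`δ ≥ 0` the set `{ξ ∈ O : |ω(ξ)·ν| ≤ δ}` has measure at most `2 J ζ^{n-1} δ / |ν|_∞`. -/
theorem resonant_set_measure_estimate
    (n : ℕ) (hn : 1 ≤ n) (U : Set (Fin n → ℝ)) (hU : IsOpen U)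
    (O : Set (Fin n → ℝ)) (hO : MeasurableSet O) (hOU : O ⊆ U)
    (ω g : (Fin n → ℝ) → (Fin n → ℝ))
    (hω : ContDiffOn ℝ 1 ω U) (hg : ContDiffOn ℝ 1 g (ω '' U))
    (hinv : ∀ ξ ∈ U, g (ω ξ) = ξ) (hinv' : ∀ y ∈ ω '' U, ω (g y) = y)
    (ζ : ℝ) (hζ : 0 < ζ) (b : Fin n → ℝ)
    (hV : ω '' U ⊆ Set.univ.pi fun i => Set.Ioo (b i) (b i + ζ))
    (J : ℝ) (hJ : ∀ y ∈ ω '' U, |(fderiv ℝ g y).det| ≤ J)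
    (ν : Fin n → ℤ) (hν : ν ≠ 0) (δ : ℝ) (hδ : 0 ≤ δ) :
    volume {ξ ∈ O | |∑ i, ω ξ i * (ν i : ℝ)| ≤ δ} ≤
      ENNReal.ofReal
        (2 * J * ζ ^ (n - 1) * δ / ((Finset.univ.sup fun i => (ν i).natAbs : ℕ) : ℝ)) := by
  rcases U.eq_empty_or_nonempty with rfl | ⟨ξ₀, hξ₀⟩
  · simp [Set.subset_empty_iff.mp hOU]
  have hJ0 : 0 ≤ J := (abs_nonneg _).trans (hJ _ (Set.mem_image_of_mem ω hξ₀))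
  obtain ⟨m, rfl⟩ : ∃ m, n = m + 1 := ⟨n - 1, by omega⟩
  have hVo : IsOpen (ω '' U) := isOpen_image_of_differentiableOn_leftInverse hU hω
    (hg.differentiableOn one_ne_zero) hinv
  obtain ⟨k, -, hk⟩ := Finset.exists_mem_eq_sup Finset.univ Finset.univ_nonempty
    fun i => (ν i).natAbs
  have hνk : ν k ≠ 0 := by
    intro h0
    refine hν (funext fun i => Int.natAbs_eq_zero.mp (Nat.le_zero.mp ?_))
    have := Finset.le_sup (f := fun i => (ν i).natAbs) (Finset.mem_univ i)
    simpa [hk, h0] using this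
  have habs : (((ν k).natAbs : ℕ) : ℝ) = |(ν k : ℝ)| := Nat.cast_natAbs (ν k) |>.trans (by simp)
  set T : Set (Fin (m + 1) → ℝ) := {y | |∑ i, y i * (ν i : ℝ)| ≤ δ} with hT_def
  have hT : MeasurableSet T := measurableSet_le (by fun_prop) measurable_const
  have hsub : {ξ ∈ O | |∑ i, ω ξ i * (ν i : ℝ)| ≤ δ} ⊆ g '' (ω '' U ∩ T) := fun ξ hξ =>
    ⟨ω ξ, ⟨Set.mem_image_of_mem ω (hOU hξ.1), hξ.2⟩, hinv ξ (hOU hξ.1)⟩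
  have hVT : MeasurableSet (ω '' U ∩ T) := hVo.measurableSet.inter hT
  calc volume {ξ ∈ O | |∑ i, ω ξ i * (ν i : ℝ)| ≤ δ}
      ≤ volume (g '' (ω '' U ∩ T)) := measure_mono hsub
    _ ≤ ∫⁻ y in ω '' U ∩ T, ENNReal.ofReal |(fderiv ℝ g y).det| :=
        addHaar_image_le_lintegral_abs_det_fderiv volume hVT fun y hy =>
          ((hg.differentiableOn one_ne_zero).differentiableAt
            (hVo.mem_nhds hy.1)).hasFDerivAt.hasFDerivWithinAt
    _ ≤ ∫⁻ _ in ω '' U ∩ T, ENNReal.ofReal J :=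
        setLIntegral_mono' hVT fun y hy => ENNReal.ofReal_le_ofReal (hJ y hy.1)
    _ = ENNReal.ofReal J * volume (ω '' U ∩ T) := setLIntegral_const _ _
    _ ≤ ENNReal.ofReal J * ENNReal.ofReal (ζ ^ m * (2 * δ / |(ν k : ℝ)|)) := by
        gcongr
        exact (measure_mono (Set.inter_subset_inter_left T hV)).trans
          (volume_cube_inter_strip_le m ζ hζ.le b (fun i => (ν i : ℝ)) k
            (Int.cast_ne_zero.mpr hνk) δ)
    _ = _ := by
        rw [← ENNReal.ofReal_mul hJ0, hk, habs, Nat.add_sub_cancel]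
        congr 1
        ring
end

section
/- Let n ≥ 1, p ≥ 1, ℓ ≥ 1 be integers, let ε > 0, λ > 0, K ≥ 1, ρ ≥ 0, and let U ⊆ ℝⁿ be open. Let A : U → M_p(ℂ) and b : U → ℂ^p be C^ℓ maps such that |∂_ξ^α A(ξ)|_∞ ≤ λ^{−|α|} ε^{2q} for every ξ ∈ U and every multi-index α with |α| ≤ ℓ, and such that ‖b‖_λ < ∞. Suppose A(ξ) is invertible for every ξ ∈ U with operator norm |A(ξ)^{−1}|₂ ≤ ε^{−2q} K^{ρ}. Then y(ξ) := A(ξ)^{−1} b(ξ) satisfies ‖y‖_λ ≤ (ℓ+1)ⁿ 2^{ℓ²} p^{3ℓ+1} ε^{−2q} K^{(ℓ+1)ρ} ‖b‖_λ. -/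
open scoped ENNReal

/-- The partial derivative `∂f/∂x_i` of a function of `n` real variables. -/
noncomputable def partialD {n : ℕ} {E : Type*} [NormedAddCommGroup E] [NormedSpace ℝ E]
    (i : Fin n) (f : (Fin n → ℝ) → E) : (Fin n → ℝ) → E :=
  fun x => fderiv ℝ f x (Pi.single i 1)

/-- The mixed partial derivative `∂^k` associated to a multi-index `k : Fin n → ℕ`. -/
noncomputable def mixedPartial {n : ℕ} {E : Type*} [NormedAddCommGroup E] [NormedSpace ℝ E]
    (k : Fin n → ℕ) (f : (Fin n → ℝ) → E) : (Fin n → ℝ) → E :=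
  ((List.ofFn fun i : Fin n => (partialD i (E := E))^[k i]).foldr (· ∘ ·) id) f

/-- The weighted norm `‖v‖_λ = Σ_{|α| ≤ ℓ} λ^{|α|} sup_{ξ ∈ U} |∂^α v(ξ)|_∞` of a map
`v : U → ℂ^p` (valued in `ℝ≥0∞` so that finiteness can be discussed). -/
noncomputable def weightedNorm (n p ℓ : ℕ) (lam : ℝ) (U : Set (Fin n → ℝ))
    (v : (Fin n → ℝ) → Fin p → ℂ) : ℝ≥0∞ :=
  ∑ α ∈ (Fintype.piFinset fun _ : Fin n => Finset.range (ℓ + 1)).filter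
      (fun α => (∑ i, α i) ≤ ℓ),
    ENNReal.ofReal (lam ^ (∑ i, α i)) *
      ⨆ ξ ∈ U, ⨆ j : Fin p, ENNReal.ofReal ‖mixedPartial α (fun x => v x j) ξ‖

/-- The `ℓ²`-operator norm of a complex `p × p` matrix. -/
noncomputable def l2OpNorm (p : ℕ) (M : Matrix (Fin p) (Fin p) ℂ) : ℝ :=
  ‖Matrix.toEuclideanCLM (𝕜 := ℂ) M‖

/-! ### Iterated partial derivatives along a list of directions -/

/-- Iterated partial derivative along a list of coordinate directions. -/
noncomputable def listPartial {n : ℕ} {E : Type*} [NormedAddCommGroup E] [NormedSpace ℝ E]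
    (L : List (Fin n)) (f : (Fin n → ℝ) → E) : (Fin n → ℝ) → E :=
  L.foldr partialD f

/-- The nondecreasing list of directions in which `i` occurs `α i` times. -/
def multiIndexList {n : ℕ} (α : Fin n → ℕ) : List (Fin n) :=
  (List.ofFn fun i => List.replicate (α i) i).flatten

lemma foldr_comp_apply {β : Type*} (fs : List (β → β)) (b : β) :
    fs.foldr (· ∘ ·) id b = fs.foldr (fun g x => g x) b := by
  induction fs with
  | nil => rfl
  | cons g fs ih => simp [ih]

lemma foldr_replicate_eq_iterate {α β : Type*} (f : α → β → β) (a : α) (k : ℕ) (b : β) :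
    (List.replicate k a).foldr f b = (f a)^[k] b := by
  induction k with
  | zero => rfl
  | succ k ih => rw [List.replicate_succ, List.foldr_cons, ih, Function.iterate_succ_apply']

lemma mixedPartial_eq_listPartial {n : ℕ} {E : Type*} [NormedAddCommGroup E] [NormedSpace ℝ E]
    (α : Fin n → ℕ) (f : (Fin n → ℝ) → E) :
    mixedPartial α f = listPartial (multiIndexList α) f := by
  have hmap : (List.ofFn fun i : Fin n => (partialD i (E := E))^[α i])
      = (List.ofFn fun i : Fin n => i).map fun i => (partialD i (E := E))^[α i] := by
    rw [List.map_ofFn]; rfl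
  have hmap' : (List.ofFn fun i : Fin n => List.replicate (α i) i)
      = (List.ofFn fun i : Fin n => i).map fun i => List.replicate (α i) i := by
    rw [List.map_ofFn]; rfl
  rw [mixedPartial, listPartial, multiIndexList, foldr_comp_apply, List.foldr_flatten, hmap,
    hmap', List.foldr_map, List.foldr_map]
  simp only [foldr_replicate_eq_iterate]

lemma pairwise_multiIndexList {n : ℕ} (α : Fin n → ℕ) :
    (multiIndexList α).Pairwise (· ≤ ·) := by
  rw [multiIndexList, List.pairwise_flatten, List.pairwise_ofFn]
  constructor
  · intro l hl
    obtain ⟨i, rfl⟩ := (List.mem_ofFn' _ _).1 hl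
    exact List.pairwise_replicate.2 (Or.inr le_rfl)
  · intro i j hij x hx y hy
    rw [List.eq_of_mem_replicate hx, List.eq_of_mem_replicate hy]
    exact hij.le

lemma length_multiIndexList {n : ℕ} (α : Fin n → ℕ) :
    (multiIndexList α).length = ∑ i, α i := by
  rw [multiIndexList, List.length_flatten, List.map_ofFn, List.sum_ofFn]
  simp

lemma count_multiIndexList {n : ℕ} (α : Fin n → ℕ) (i : Fin n) :
    (multiIndexList α).count i = α i := by
  rw [multiIndexList, List.count_flatten, List.map_ofFn, List.sum_ofFn]
  simp [List.count_replicate]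

lemma multiIndexList_count {n : ℕ} {L : List (Fin n)} (hL : L.Pairwise (· ≤ ·)) :
    multiIndexList (fun i => L.count i) = L :=
  List.Perm.eq_of_pairwise (fun _ _ _ _ => le_antisymm) (pairwise_multiIndexList _) hL
    (List.perm_iff_count.2 fun i => count_multiIndexList _ i)

lemma sum_count_eq_length {n : ℕ} (L : List (Fin n)) : ∑ i, L.count i = L.length := by
  simpa using Multiset.sum_count_eq_card (s := Finset.univ) (m := (L : Multiset (Fin n)))
    fun a _ => Finset.mem_univ a

lemma partialD_congr {n : ℕ} {E : Type*} [NormedAddCommGroup E] [NormedSpace ℝ E]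
    {U : Set (Fin n → ℝ)} (hU : IsOpen U) {f g : (Fin n → ℝ) → E} (h : Set.EqOn f g U)
    (i : Fin n) : Set.EqOn (partialD i f) (partialD i g) U := by
  intro x hx
  have : f =ᶠ[nhds x] g := Filter.eventuallyEq_of_mem (hU.mem_nhds hx) h
  simp only [partialD, this.fderiv_eq]

lemma listPartial_congr {n : ℕ} {E : Type*} [NormedAddCommGroup E] [NormedSpace ℝ E]
    {U : Set (Fin n → ℝ)} (hU : IsOpen U) {f g : (Fin n → ℝ) → E} (h : Set.EqOn f g U)
    (L : List (Fin n)) : Set.EqOn (listPartial L f) (listPartial L g) U := by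
  induction L with
  | nil => exact h
  | cons i L ih => exact partialD_congr hU ih i

lemma contDiffOn_listPartial {n : ℕ} {E : Type*} [NormedAddCommGroup E] [NormedSpace ℝ E]
    {U : Set (Fin n → ℝ)} (hU : IsOpen U) {f : (Fin n → ℝ) → E} (L : List (Fin n)) (m : ℕ)
    (hf : ContDiffOn ℝ ((m + L.length : ℕ) : WithTop ℕ∞) f U) :
    ContDiffOn ℝ m (listPartial L f) U := by
  induction L generalizing m with
  | nil => exact hf
  | cons i L ih =>
    have h : ContDiffOn ℝ ((m + 1 : ℕ) : WithTop ℕ∞) (listPartial L f) U :=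
      ih (m + 1) (by rwa [List.length_cons, ← add_assoc, add_right_comm] at hf)
    exact (h.fderiv_of_isOpen hU (by push_cast; exact le_rfl)).clm_apply contDiffOn_const

lemma differentiableAt_listPartial {n : ℕ} {E : Type*} [NormedAddCommGroup E] [NormedSpace ℝ E]
    {U : Set (Fin n → ℝ)} (hU : IsOpen U) {f : (Fin n → ℝ) → E} (L : List (Fin n)) {m : ℕ}
    (hf : ContDiffOn ℝ m f U) (hm : L.length < m) {x : Fin n → ℝ} (hx : x ∈ U) :
    DifferentiableAt ℝ (listPartial L f) x := by
  have h : ContDiffOn ℝ (1 : ℕ) (listPartial L f) U :=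
    contDiffOn_listPartial hU L 1 (hf.of_le (by exact_mod_cast (by omega : 1 + L.length ≤ m)))
  exact (h.differentiableOn (by simp)).differentiableAt (hU.mem_nhds hx)

lemma listPartial_sum {n : ℕ} {E ι : Type*} [NormedAddCommGroup E] [NormedSpace ℝ E]
    {U : Set (Fin n → ℝ)} (hU : IsOpen U) (s : Finset ι) {f : ι → (Fin n → ℝ) → E}
    (L : List (Fin n)) (hf : ∀ j ∈ s, ContDiffOn ℝ L.length (f j) U) :
    Set.EqOn (listPartial L fun x => ∑ j ∈ s, f j x)
      (fun x => ∑ j ∈ s, listPartial L (f j) x) U := by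
  induction L with
  | nil => exact fun x _ => rfl
  | cons i L ih =>
    have hf' : ∀ j ∈ s, ContDiffOn ℝ L.length (f j) U := fun j hj =>
      (hf j hj).of_le (by exact_mod_cast (by simp : L.length ≤ (i :: L).length))
    refine (partialD_congr hU (ih hf') i).trans fun x hx => ?_
    rw [partialD, fderiv_fun_sum fun j hj =>
      differentiableAt_listPartial hU L (hf j hj) (by simp) hx]
    rw [sum_apply]
    rfl

/-! ### The Leibniz rule -/

/-- The ways of distributing the directions of a list between the two factors of a product, the
first factor receiving at least one of them. -/
def properSplits {α : Type*} : List α → List (List α × List α)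
  | [] => []
  | i :: L => ([i], L) :: ((properSplits L).map (fun s => (s.1, i :: s.2)) ++
      (properSplits L).map fun s => (i :: s.1, s.2))

lemma length_properSplits_add_one {α : Type*} (L : List α) :
    (properSplits L).length + 1 = 2 ^ L.length := by
  induction L with
  | nil => rfl
  | cons i L ih =>
    simp only [properSplits, List.length_cons, List.length_append, List.length_map, pow_succ,
      ← ih]
    ring

lemma properSplits_spec {α : Type*} (L : List α) : ∀ s ∈ properSplits L,
    s.1.Sublist L ∧ s.2.Sublist L ∧ s.1.length + s.2.length = L.length ∧
      s.2.length < L.length := by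
  induction L with
  | nil => simp [properSplits]
  | cons i L ih =>
    intro s hs
    simp only [properSplits, List.mem_cons, List.mem_append, List.mem_map] at hs
    rcases hs with rfl | ⟨t, ht, rfl⟩ | ⟨t, ht, rfl⟩
    · simp [add_comm]
    · obtain ⟨h1, h2, h3, h4⟩ := ih t ht
      refine ⟨h1.cons i, h2.cons_cons i, ?_, ?_⟩ <;> simp <;> omega
    · obtain ⟨h1, h2, h3, h4⟩ := ih t ht
      refine ⟨h1.cons_cons i, h2.cons i, ?_, ?_⟩ <;> simp <;> omega

lemma hasFDerivAt_list_sum {E F κ : Type*} [NormedAddCommGroup E] [NormedSpace ℝ E]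
    [NormedAddCommGroup F] [NormedSpace ℝ F] {x : E} (T : List κ) {f : κ → E → F}
    {f' : κ → E →L[ℝ] F} (h : ∀ s ∈ T, HasFDerivAt (f s) (f' s) x) :
    HasFDerivAt (fun x => (T.map fun s => f s x).sum) (T.map f').sum x := by
  induction T with
  | nil => simpa using hasFDerivAt_const (0 : F) x
  | cons s T ih =>
    simp only [List.map_cons, List.sum_cons]
    exact (h s (by simp)).add (ih fun t ht => h t (by simp [ht]))

lemma listPartial_mul {n : ℕ} {U : Set (Fin n → ℝ)} (hU : IsOpen U) {f g : (Fin n → ℝ) → ℂ}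
    (L : List (Fin n)) (hf : ContDiffOn ℝ L.length f U) (hg : ContDiffOn ℝ L.length g U) :
    Set.EqOn (listPartial L fun x => f x * g x)
      (fun x => f x * listPartial L g x +
        ((properSplits L).map fun s => listPartial s.1 f x * listPartial s.2 g x).sum) U := by
  induction L with
  | nil => intro x _; simp [properSplits, listPartial]
  | cons i L ih =>
    have hle : (L.length : WithTop ℕ∞) ≤ (i :: L).length := by
      exact_mod_cast (by simp : L.length ≤ (i :: L).length)
    refine (partialD_congr hU (ih (hf.of_le hle) (hg.of_le hle)) i).trans fun x hx => ?_
    have hd : ∀ {h : (Fin n → ℝ) → ℂ}, ContDiffOn ℝ (i :: L).length h U → ∀ M : List (Fin n),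
        M.length ≤ L.length →
        HasFDerivAt (listPartial M h) (fderiv ℝ (listPartial M h) x) x := fun hh M hM =>
      (differentiableAt_listPartial hU M hh (by simp; omega) hx).hasFDerivAt
    have hmain := ((hd hf [] (by simp)).mul (hd hg L le_rfl)).add
      (hasFDerivAt_list_sum (properSplits L) fun s hs =>
        (hd hf s.1 (properSplits_spec L s hs).1.length_le).mul
          (hd hg s.2 (properSplits_spec L s hs).2.1.length_le))
    have hsum : ∀ (T : List (List (Fin n) × List (Fin n)))
        (φ : List (Fin n) × List (Fin n) → (Fin n → ℝ) →L[ℝ] ℂ) (v : Fin n → ℝ),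
        (T.map φ).sum v = (T.map fun s => φ s v).sum := by
      intro T φ v
      induction T with
      | nil => simp
      | cons s T ih => simp [ih]
    rw [partialD]
    refine (congrArg (fun φ : (Fin n → ℝ) →L[ℝ] ℂ => φ (Pi.single i 1)) hmain.fderiv).trans ?_
    simp only [add_apply, hsum, smul_apply, smul_eq_mul,
      properSplits, List.map_cons, List.sum_cons, List.map_append, List.sum_append, List.map_map,
      Function.comp_def, List.sum_map_add]
    simp only [listPartial, List.foldr_cons, List.foldr_nil, partialD]
    simp only [mul_comm]
    ring

/-! ### Matrices -/

lemma contDiffOn_matrix_det {E : Type*} [NormedAddCommGroup E] [NormedSpace ℝ E] {p : ℕ}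
    {m : WithTop ℕ∞} {U : Set E} {A : E → Matrix (Fin p) (Fin p) ℂ}
    (hA : ∀ i j, ContDiffOn ℝ m (fun x => A x i j) U) :
    ContDiffOn ℝ m (fun x => (A x).det) U := by
  simp only [Matrix.det_apply']
  exact ContDiffOn.sum fun σ _ => contDiffOn_const.mul (contDiffOn_prod fun i _ => hA _ _)

lemma contDiffOn_matrix_inv {E : Type*} [NormedAddCommGroup E] [NormedSpace ℝ E] {p : ℕ}
    {m : WithTop ℕ∞} {U : Set E} {A : E → Matrix (Fin p) (Fin p) ℂ}
    (hA : ∀ i j, ContDiffOn ℝ m (fun x => A x i j) U) (hunit : ∀ x ∈ U, IsUnit (A x))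
    (i j : Fin p) : ContDiffOn ℝ m (fun x => (A x)⁻¹ i j) U := by
  simp only [Matrix.inv_def, Ring.inverse_eq_inv', Matrix.smul_apply, smul_eq_mul,
    Matrix.adjugate_apply]
  refine ((contDiffOn_matrix_det hA).inv fun x hx =>
    ((Matrix.isUnit_iff_isUnit_det _).1 (hunit x hx)).ne_zero).mul
      (contDiffOn_matrix_det fun k l => ?_)
  by_cases hk : k = j
  · subst hk
    simp [contDiffOn_const]
  · simpa [Matrix.updateRow_ne hk] using hA k l

lemma norm_entry_le_l2OpNorm {p : ℕ} (M : Matrix (Fin p) (Fin p) ℂ) (i j : Fin p) :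
    ‖M i j‖ ≤ l2OpNorm p M := by
  have h := ((Matrix.toEuclideanCLM (𝕜 := ℂ) M).le_opNorm
    (WithLp.toLp 2 (Pi.single j 1))).trans' (PiLp.norm_apply_le _ i)
  have h1 : ‖(WithLp.toLp 2 (Pi.single j 1) : EuclideanSpace ℂ (Fin p))‖ = 1 := by
    simp
  rw [Matrix.toEuclideanCLM_toLp, h1, mul_one] at h
  simpa [l2OpNorm] using h

/-! ### Weighted bounds -/

lemma norm_listPartial_le_weightedNorm {n p ℓ : ℕ} {lam : ℝ} (hlam : 0 < lam)
    {U : Set (Fin n → ℝ)} {b : (Fin n → ℝ) → Fin p → ℂ} (hb : weightedNorm n p ℓ lam U b ≠ ⊤)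
    {L : List (Fin n)} (hL : L.Pairwise (· ≤ ·)) (hlen : L.length ≤ ℓ) {ξ : Fin n → ℝ}
    (hξ : ξ ∈ U) (j : Fin p) :
    lam ^ L.length * ‖listPartial L (fun x => b x j) ξ‖ ≤
      (weightedNorm n p ℓ lam U b).toReal := by
  rw [← ENNReal.ofReal_le_iff_le_toReal hb, ENNReal.ofReal_mul (by positivity)]
  have hmem : (fun i => L.count i) ∈ (Fintype.piFinset fun _ : Fin n =>
      Finset.range (ℓ + 1)).filter (fun α => (∑ i, α i) ≤ ℓ) := by
    simp only [Finset.mem_filter, Fintype.mem_piFinset, Finset.mem_range, sum_count_eq_length]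
    exact ⟨fun i => by have := L.count_le_length (a := i); omega, hlen⟩
  refine le_trans ?_ (Finset.single_le_sum (fun _ _ => zero_le) hmem)
  rw [sum_count_eq_length, ← multiIndexList_count hL, ← mixedPartial_eq_listPartial,
    multiIndexList_count hL]
  gcongr
  exact le_iSup₂_of_le ξ hξ (le_iSup_of_le j le_rfl)

lemma weightedNorm_le {n p ℓ : ℕ} {lam C : ℝ} (hlam : 0 < lam)
    {U : Set (Fin n → ℝ)} {y : (Fin n → ℝ) → Fin p → ℂ}
    (h : ∀ α : Fin n → ℕ, ∑ i, α i ≤ ℓ → ∀ ξ ∈ U, ∀ j,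
      lam ^ (∑ i, α i) * ‖mixedPartial α (fun x => y x j) ξ‖ ≤ C) :
    weightedNorm n p ℓ lam U y ≤ ((ℓ + 1) ^ n : ℕ) * ENNReal.ofReal C := by
  refine (Finset.sum_le_card_nsmul _ _ (ENNReal.ofReal C) fun α hα => ?_).trans ?_
  · simp only [ENNReal.mul_iSup]
    refine iSup₂_le fun ξ hξ => iSup_le fun j => ?_
    rw [← ENNReal.ofReal_mul (by positivity)]
    exact ENNReal.ofReal_le_ofReal (h α (Finset.mem_filter.1 hα).2 ξ hξ j)
  · rw [nsmul_eq_mul]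
    gcongr
    refine (Finset.card_filter_le _ _).trans ?_
    rw [Fintype.card_piFinset_const, Finset.card_range]

/-- The constant bounding the derivatives of order `k` of the solution. -/
noncomputable def solutionConst (p : ℕ) (κ : ℝ) (k : ℕ) : ℝ :=
  2 ^ (k ^ 2) * (p : ℝ) ^ (3 * k + 1) * κ ^ (k + 1)

lemma solutionConst_mono {p : ℕ} (hp : 1 ≤ p) {κ : ℝ} (hκ : 1 ≤ κ) :
    Monotone (solutionConst p κ) := by
  intro j k hjk
  have hp' : (1 : ℝ) ≤ p := by exact_mod_cast hp
  unfold solutionConst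
  gcongr
  · norm_num

lemma solutionConst_recurrence {p : ℕ} (hp : 1 ≤ p) {κ : ℝ} (hκ : 1 ≤ κ) (k : ℕ) :
    p * κ * (1 + p * ((2 ^ k - 1) * solutionConst p κ (k - 1))) ≤ solutionConst p κ k := by
  have hp' : (1 : ℝ) ≤ p := by exact_mod_cast hp
  rcases k with _ | m
  · simp [solutionConst]
  have hone : 1 ≤ (p : ℝ) * solutionConst p κ m := by
    have h1 : (1 : ℝ) ≤ 2 ^ (m ^ 2) := one_le_pow₀ (by norm_num)
    have h2 : (1 : ℝ) ≤ p ^ (3 * m + 1) := one_le_pow₀ hp'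
    have h3 : (1 : ℝ) ≤ κ ^ (m + 1) := one_le_pow₀ hκ
    exact one_le_mul_of_one_le_of_one_le hp'
      (one_le_mul_of_one_le_of_one_le (one_le_mul_of_one_le_of_one_le h1 h2) h3)
  calc (p : ℝ) * κ * (1 + p * ((2 ^ (m + 1) - 1) * solutionConst p κ m))
      ≤ p * κ * (p * solutionConst p κ m + p * ((2 ^ (m + 1) - 1) * solutionConst p κ m)) := by
        gcongr
    _ = 2 ^ (m ^ 2 + m + 1) * p ^ (3 * m + 3) * κ ^ (m + 2) := by
        unfold solutionConst; ring
    _ ≤ 2 ^ ((m + 1) ^ 2) * p ^ (3 * (m + 1) + 1) * κ ^ (m + 2) := by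
        refine mul_le_mul_of_nonneg_right (mul_le_mul (pow_le_pow_right₀ one_le_two ?_)
          (pow_le_pow_right₀ hp' ?_) (by positivity) (by positivity)) (by positivity)
        · nlinarith
        · omega

lemma norm_list_sum_map_le {κ : Type*} (T : List κ) (f : κ → ℂ) {c : ℝ}
    (h : ∀ s ∈ T, ‖f s‖ ≤ c) : ‖(T.map f).sum‖ ≤ T.length * c := by
  induction T with
  | nil => simp
  | cons s T ih =>
    simp only [List.map_cons, List.sum_cons, List.length_cons, Nat.cast_add, Nat.cast_one]
    have h1 := h s (by simp)
    have h2 := ih fun t ht => h t (by simp [ht])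
    linarith [norm_add_le (f s) (T.map f).sum]

/-- Derivatives of the solution `y` of a linear system `A y = b`, estimated by solving the
differentiated system for the top order derivative of `y`. -/
lemma norm_listPartial_solution_le {n p ℓ : ℕ} (hp : 1 ≤ p) {lam E κ B : ℝ} (hlam : 0 < lam)
    (hE : 0 < E) (hκ : 1 ≤ κ) (hB : 0 ≤ B) {U : Set (Fin n → ℝ)} (hU : IsOpen U)
    {A : (Fin n → ℝ) → Matrix (Fin p) (Fin p) ℂ} {b y : (Fin n → ℝ) → Fin p → ℂ}
    (hAsmooth : ∀ i j, ContDiffOn ℝ ℓ (fun ξ => A ξ i j) U)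
    (hysmooth : ∀ j, ContDiffOn ℝ ℓ (fun ξ => y ξ j) U)
    (hunit : ∀ ξ ∈ U, IsUnit (A ξ))
    (hAy : ∀ ξ ∈ U, (A ξ).mulVec (y ξ) = b ξ)
    (hA : ∀ L : List (Fin n), L.Pairwise (· ≤ ·) → L.length ≤ ℓ → ∀ ξ ∈ U, ∀ i j,
      lam ^ L.length * ‖listPartial L (fun x => A x i j) ξ‖ ≤ E)
    (hAinv : ∀ ξ ∈ U, ∀ i j, ‖(A ξ)⁻¹ i j‖ ≤ E⁻¹ * κ)
    (hb : ∀ L : List (Fin n), L.Pairwise (· ≤ ·) → L.length ≤ ℓ → ∀ ξ ∈ U, ∀ j,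
      lam ^ L.length * ‖listPartial L (fun x => b x j) ξ‖ ≤ B)
    (L : List (Fin n)) (hL : L.Pairwise (· ≤ ·)) (hlen : L.length ≤ ℓ) {ξ : Fin n → ℝ}
    (hξ : ξ ∈ U) (j : Fin p) :
    lam ^ L.length * ‖listPartial L (fun x => y x j) ξ‖ ≤
      E⁻¹ * solutionConst p κ L.length * B := by
  induction hk : L.length using Nat.strong_induction_on generalizing L j with
  | _ k ih =>
  subst hk
  set C := solutionConst p κ (L.length - 1) with hC
  have hC0 : 0 ≤ C := by rw [hC, solutionConst]; positivity
  set R : Fin p → Fin p → ℂ := fun i j => ((properSplits L).map fun s =>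
    listPartial s.1 (fun x => A x i j) ξ * listPartial s.2 (fun x => y x j) ξ).sum with hR
  have hle : (L.length : WithTop ℕ∞) ≤ ℓ := by exact_mod_cast hlen
  have hdiff : ∀ i, listPartial L (fun x => b x i) ξ =
      ∑ j, (A ξ i j * listPartial L (fun x => y x j) ξ + R i j) := by
    intro i
    have h1 : Set.EqOn (fun x => b x i) (fun x => ∑ j, A x i j * y x j) U := fun x hx =>
      (congrFun (hAy x hx) i).symm
    rw [listPartial_congr hU h1 L hξ, listPartial_sum hU Finset.univ L
      (fun j _ => ((hAsmooth i j).of_le hle).mul ((hysmooth j).of_le hle)) hξ]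
    exact Finset.sum_congr rfl fun j _ => listPartial_mul hU L ((hAsmooth i j).of_le hle)
      ((hysmooth j).of_le hle) hξ
  have hRbound : ∀ i j, lam ^ L.length * ‖R i j‖ ≤ (2 ^ L.length - 1) * (C * B) := by
    intro i j
    have hcard : ((properSplits L).length : ℝ) = 2 ^ L.length - 1 :=
      eq_sub_of_add_eq (by exact_mod_cast length_properSplits_add_one L)
    have hterm : ∀ s ∈ properSplits L, ‖listPartial s.1 (fun x => A x i j) ξ *
        listPartial s.2 (fun x => y x j) ξ‖ ≤ (lam ^ L.length)⁻¹ * (C * B) := by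
      intro s hs
      obtain ⟨h1, h2, h3, h4⟩ := properSplits_spec L s hs
      have ha := hA s.1 (hL.sublist h1) (h1.length_le.trans hlen) ξ hξ i j
      have hy := ih s.2.length h4 s.2 (hL.sublist h2) (h2.length_le.trans hlen) j rfl
      have hmono : solutionConst p κ s.2.length ≤ C :=
        solutionConst_mono hp hκ (by omega)
      have hy' : lam ^ s.2.length * ‖listPartial s.2 (fun x => y x j) ξ‖ ≤ E⁻¹ * C * B :=
        hy.trans (by gcongr)
      rw [norm_mul, le_inv_mul_iff₀ (by positivity), ← h3, pow_add]
      calc _ = (lam ^ s.1.length * ‖listPartial s.1 (fun x => A x i j) ξ‖) *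
            (lam ^ s.2.length * ‖listPartial s.2 (fun x => y x j) ξ‖) := by ring
        _ ≤ E * (E⁻¹ * C * B) := by gcongr
        _ = C * B := by field_simp
    have h := norm_list_sum_map_le _ _ hterm
    rw [hcard] at h
    calc lam ^ L.length * ‖R i j‖
        ≤ lam ^ L.length * ((2 ^ L.length - 1) * ((lam ^ L.length)⁻¹ * (C * B))) := by gcongr
      _ = _ := by field_simp
  have hsolve : listPartial L (fun x => y x j) ξ =
      ∑ i, (A ξ)⁻¹ j i * (listPartial L (fun x => b x i) ξ - ∑ j, R i j) := by
    have h1 : (A ξ).mulVec (fun j => listPartial L (fun x => y x j) ξ) =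
        fun i => listPartial L (fun x => b x i) ξ - ∑ j, R i j := by
      funext i
      rw [hdiff i, Finset.sum_add_distrib, add_sub_cancel_right]
      rfl
    have h2 := congrArg (fun v => (A ξ)⁻¹.mulVec v j) h1
    simp only [Matrix.mulVec_mulVec,
      Matrix.nonsing_inv_mul _ ((Matrix.isUnit_iff_isUnit_det _).1 (hunit ξ hξ)),
      Matrix.one_mulVec] at h2
    exact h2
  have hrhs : ∀ i, lam ^ L.length * ‖listPartial L (fun x => b x i) ξ - ∑ j, R i j‖ ≤
      B * (1 + p * ((2 ^ L.length - 1) * C)) := by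
    intro i
    have hsum : lam ^ L.length * ‖∑ j, R i j‖ ≤ p * ((2 ^ L.length - 1) * (C * B)) := by
      calc lam ^ L.length * ‖∑ j, R i j‖ ≤ lam ^ L.length * ∑ j, ‖R i j‖ := by
            gcongr; exact norm_sum_le _ _
        _ = ∑ j, lam ^ L.length * ‖R i j‖ := Finset.mul_sum _ _ _
        _ ≤ ∑ _j : Fin p, (2 ^ L.length - 1) * (C * B) :=
            Finset.sum_le_sum fun j _ => hRbound i j
        _ = _ := by simp
    calc lam ^ L.length * ‖listPartial L (fun x => b x i) ξ - ∑ j, R i j‖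
        ≤ lam ^ L.length * (‖listPartial L (fun x => b x i) ξ‖ + ‖∑ j, R i j‖) := by
          gcongr; exact norm_sub_le _ _
      _ ≤ B + p * ((2 ^ L.length - 1) * (C * B)) := by
          rw [mul_add]; exact add_le_add (hb L hL hlen ξ hξ i) hsum
      _ = _ := by ring
  calc lam ^ L.length * ‖listPartial L (fun x => y x j) ξ‖
      ≤ lam ^ L.length * ∑ i, ‖(A ξ)⁻¹ j i * (listPartial L (fun x => b x i) ξ - ∑ j, R i j)‖ := by
        rw [hsolve]; gcongr; exact norm_sum_le _ _
    _ = ∑ i, ‖(A ξ)⁻¹ j i‖ *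
          (lam ^ L.length * ‖listPartial L (fun x => b x i) ξ - ∑ j, R i j‖) := by
        rw [Finset.mul_sum]
        exact Finset.sum_congr rfl fun i _ => by rw [norm_mul]; ring
    _ ≤ ∑ _i : Fin p, E⁻¹ * κ * (B * (1 + p * ((2 ^ L.length - 1) * C))) :=
        Finset.sum_le_sum fun i _ => mul_le_mul (hAinv ξ hξ j i) (hrhs i) (by positivity)
          (by positivity)
    _ = E⁻¹ * (p * κ * (1 + p * ((2 ^ L.length - 1) * C))) * B := by
        rw [Finset.sum_const, Finset.card_univ, Fintype.card_fin, nsmul_eq_mul]; ring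
    _ ≤ E⁻¹ * solutionConst p κ L.length * B := by
        gcongr; exact solutionConst_recurrence hp hκ _

/-- (Lemma A.4, tecni4.) Solving `A y = b`: if `|∂^α A|_∞ ≤ λ^{-|α|} ε^{2q}`
for `|α| ≤ ℓ`, `‖b‖_λ < ∞`, `A(ξ)` is invertible with `|A(ξ)⁻¹|₂ ≤ ε^{-2q} K^ρ`, then
`y = A⁻¹ b` satisfies `‖y‖_λ ≤ (ℓ+1)ⁿ 2^{ℓ²} p^{3ℓ+1} ε^{-2q} K^{(ℓ+1)ρ} ‖b‖_λ`. -/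
theorem inverse_matrix_weighted_norm_estimate
    (n p ℓ q : ℕ) (hn : 1 ≤ n) (hp : 1 ≤ p) (hℓ : 1 ≤ ℓ) (hq : 1 ≤ q)
    (ε lam K ρ : ℝ) (hε : 0 < ε) (hlam : 0 < lam) (hK : 1 ≤ K) (hρ : 0 ≤ ρ)
    (U : Set (Fin n → ℝ)) (hU : IsOpen U)
    (A : (Fin n → ℝ) → Matrix (Fin p) (Fin p) ℂ)
    (b : (Fin n → ℝ) → Fin p → ℂ)
    (hAsmooth : ∀ a b' : Fin p, ContDiffOn ℝ ℓ (fun ξ => A ξ a b') U)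
    (hbsmooth : ∀ j : Fin p, ContDiffOn ℝ ℓ (fun ξ => b ξ j) U)
    (hAbound : ∀ ξ ∈ U, ∀ α : Fin n → ℕ, (∑ i, α i) ≤ ℓ → ∀ a b' : Fin p,
      ‖mixedPartial α (fun x => A x a b') ξ‖ ≤ lam ^ (-(∑ i, α i : ℤ)) * ε ^ (2 * q))
    (hbfin : weightedNorm n p ℓ lam U b ≠ ⊤)
    (hAinv : ∀ ξ ∈ U, IsUnit (A ξ) ∧
      l2OpNorm p ((A ξ)⁻¹) ≤ ε ^ (-(2 * q : ℤ)) * K ^ ρ) :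
    weightedNorm n p ℓ lam U (fun ξ => Matrix.mulVec ((A ξ)⁻¹) (b ξ)) ≤
      ENNReal.ofReal (((ℓ : ℝ) + 1) ^ n * 2 ^ (ℓ ^ 2) * (p : ℝ) ^ (3 * ℓ + 1) *
          ε ^ (-(2 * q : ℤ)) * K ^ (((ℓ : ℝ) + 1) * ρ)) *
        weightedNorm n p ℓ lam U b := by
  set B := (weightedNorm n p ℓ lam U b).toReal with hBdef
  set κ := K ^ ρ with hκdef
  have hκ : 1 ≤ κ := Real.one_le_rpow hK hρ
  have hE : 0 < ε ^ (2 * q) := by positivity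
  have hEinv : ε ^ (-(2 * q : ℤ)) = (ε ^ (2 * q))⁻¹ := by
    rw [zpow_neg]; norm_cast
  have hA : ∀ L : List (Fin n), L.Pairwise (· ≤ ·) → L.length ≤ ℓ → ∀ ξ ∈ U, ∀ i j,
      lam ^ L.length * ‖listPartial L (fun x => A x i j) ξ‖ ≤ ε ^ (2 * q) := by
    intro L hL hlen ξ hξ i j
    have h := hAbound ξ hξ (fun i => L.count i) (by rwa [sum_count_eq_length]) i j
    rw [mixedPartial_eq_listPartial, multiIndexList_count hL, ← Nat.cast_sum,
      sum_count_eq_length, zpow_neg, zpow_natCast] at h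
    rwa [← le_inv_mul_iff₀ (by positivity)]
  have hAinv' : ∀ ξ ∈ U, ∀ i j, ‖(A ξ)⁻¹ i j‖ ≤ (ε ^ (2 * q))⁻¹ * κ := fun ξ hξ i j =>
    hEinv ▸ (norm_entry_le_l2OpNorm _ i j).trans (hAinv ξ hξ).2
  have hysmooth : ∀ j, ContDiffOn ℝ ℓ (fun ξ => ((A ξ)⁻¹.mulVec (b ξ)) j) U := fun j => by
    simp only [Matrix.mulVec, dotProduct]
    exact ContDiffOn.sum fun i _ => (contDiffOn_matrix_inv hAsmooth (fun ξ hξ => (hAinv ξ hξ).1)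
      j i).mul (hbsmooth i)
  have hAy : ∀ ξ ∈ U, (A ξ).mulVec ((A ξ)⁻¹.mulVec (b ξ)) = b ξ := fun ξ hξ => by
    rw [Matrix.mulVec_mulVec, Matrix.mul_nonsing_inv _
      ((Matrix.isUnit_iff_isUnit_det _).1 (hAinv ξ hξ).1), Matrix.one_mulVec]
  refine (weightedNorm_le (C := (ε ^ (2 * q))⁻¹ * solutionConst p κ ℓ * B) hlam
    fun α hα ξ hξ j => ?_).trans ?_
  · rw [mixedPartial_eq_listPartial, ← length_multiIndexList]
    rw [← length_multiIndexList] at hα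
    refine (norm_listPartial_solution_le hp hlam hE hκ ENNReal.toReal_nonneg hU hAsmooth hysmooth
      (fun ξ hξ => (hAinv ξ hξ).1) hAy hA hAinv'
      (fun L hL hlen ξ hξ j => norm_listPartial_le_weightedNorm hlam hbfin hL hlen hξ j)
      _ (pairwise_multiIndexList α) hα hξ j).trans ?_
    gcongr
    exact solutionConst_mono hp hκ hα
  · rw [← ENNReal.ofReal_toReal hbfin, ← hBdef, ← ENNReal.ofReal_natCast,
      ← ENNReal.ofReal_mul (by positivity), ← ENNReal.ofReal_mul (by positivity)]
    refine ENNReal.ofReal_le_ofReal (le_of_eq ?_)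
    have hKpow : K ^ (((ℓ : ℝ) + 1) * ρ) = κ ^ (ℓ + 1) := by
      rw [hκdef, ← Real.rpow_natCast, ← Real.rpow_mul (by linarith)]
      push_cast
      ring_nf
    rw [hKpow, hEinv, solutionConst]
    push_cast
    ring
end

section
/- For every integer q ≥ 1 and every i ∈ {1,…,n}, the polynomial ω^{(1)}_i(ξ) + q(q+1) ξ_i^{q} has the property that every monomial in its support involves at least two distinct variables, i.e. has positive exponent in at least two of the variables ξ₁,…,ξₙ. Equivalently, ω^{(1)}_i(ξ) equals −q(q+1) ξ_i^{q} plus terms each of which contains at least two variables. -/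
/-- The polynomial `A_r(ξ) = Σ_{|k| = r} (r!/(k₁!⋯kₙ!))² ξ^k`. -/
noncomputable def Apoly (n r : ℕ) : MvPolynomial (Fin n) ℝ :=
  ∑ k ∈ (Fintype.piFinset fun _ : Fin n => Finset.range (r + 1)).filter
      (fun k => (∑ i, k i) = r),
    MvPolynomial.C ((Nat.multinomial Finset.univ k : ℝ) ^ 2) *
      ∏ i, MvPolynomial.X i ^ k i

/-- The frequency modulation `ω⁽¹⁾_i(ξ) = ∂_{ξ_i} A_{q+1}(ξ) − (q+1)² A_q(ξ)` of the q-NLS. -/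
noncomputable def omega1 (n q : ℕ) (i : Fin n) : MvPolynomial (Fin n) ℝ :=
  MvPolynomial.pderiv i (Apoly n (q + 1)) -
    MvPolynomial.C (((q : ℝ) + 1) ^ 2) * Apoly n q

theorem coeff_Apoly (n r : ℕ) (d : Fin n →₀ ℕ) :
    (Apoly n r).coeff d =
      if ∑ j, d j = r then (Nat.multinomial Finset.univ d : ℝ) ^ 2 else 0 := by
  have hterm (k : Fin n → ℕ) (a : ℝ) :
      (MvPolynomial.C a * ∏ j, MvPolynomial.X j ^ k j : MvPolynomial (Fin n) ℝ).coeff d =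
        if k = d then a else 0 := by
    have hk : (MvPolynomial.C a * ∏ j, MvPolynomial.X j ^ k j : MvPolynomial (Fin n) ℝ) =
        MvPolynomial.monomial (Finsupp.equivFunOnFinite.symm k) a := by
      rw [MvPolynomial.monomial_eq, Finsupp.prod_fintype _ _ (by simp)]
      simp
    rw [hk, MvPolynomial.coeff_monomial]
    simp only [Equiv.symm_apply_eq]
    rfl
  simp only [Apoly, MvPolynomial.coeff_sum, hterm, Finset.sum_ite_eq', Finset.mem_filter,
    Fintype.mem_piFinset, Finset.mem_range, Order.lt_add_one_iff]
  refine if_congr (and_iff_right_of_imp fun h j => ?_) rfl rfl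
  exact h ▸ Finset.single_le_sum (f := d) (fun _ _ => Nat.zero_le _) (Finset.mem_univ j)

theorem multinomial_univ_single {n : ℕ} (j : Fin n) (m : ℕ) :
    Nat.multinomial Finset.univ (Finsupp.single j m) = 1 := by
  have h := Nat.multinomial_spec Finset.univ (Finsupp.single j m)
  rw [Finset.prod_eq_single j (by intro b _ hb; simp [hb.symm]) (by simp)] at h
  simpa [Finsupp.single_apply, Nat.factorial_ne_zero] using h

theorem multinomial_univ_single_add_single_one {n : ℕ} {i j : Fin n} (hij : i ≠ j) (m : ℕ) :
    Nat.multinomial Finset.univ (Finsupp.single j m + Finsupp.single i 1 : Fin n →₀ ℕ) =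
      m + 1 := by
  have h := Nat.multinomial_spec Finset.univ
    (Finsupp.single j m + Finsupp.single i 1 : Fin n →₀ ℕ)
  rw [Finset.prod_eq_single j
    (by intro b _ hb; by_cases hb' : i = b <;> simp [hb.symm, hb'])
    (by simp)] at h
  simp only [Finsupp.add_apply, Finset.sum_add_distrib, Finsupp.single_apply, Finset.sum_ite_eq,
    Finset.mem_univ, if_true, if_neg hij, add_zero, Nat.factorial_succ] at h
  exact Nat.eq_of_mul_eq_mul_left (Nat.factorial_pos m) (h.trans (mul_comm _ _))

/-- (Lemma `omest`.) The polynomial `ω⁽¹⁾_i(ξ) + q(q+1) ξ_i^q` only contains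
monomials involving at least two distinct variables; equivalently, `ω⁽¹⁾_i(ξ)` equals
`−q(q+1) ξ_i^q` plus terms each containing at least two variables. -/
theorem omega1_pure_power_term (n q : ℕ) (hn : 1 ≤ n) (hq : 1 ≤ q) (i : Fin n)
    (d : Fin n →₀ ℕ)
    (hd : d ∈ (omega1 n q i +
      MvPolynomial.C ((q : ℝ) * ((q : ℝ) + 1)) * MvPolynomial.X i ^ q).support) :
    2 ≤ d.support.card := by
  by_contra hcard
  have : Nonempty (Fin n) := ⟨i⟩
  obtain ⟨j, m, rfl⟩ := Finsupp.card_support_le_one'.mp (by omega : d.support.card ≤ 1)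
  apply MvPolynomial.mem_support_iff.mp hd
  have hsum : ∑ k, (Finsupp.single j m) k = m := by simp [Finsupp.single_apply]
  have hsum' : ∑ k, (Finsupp.single j m + Finsupp.single i 1 : Fin n →₀ ℕ) k = m + 1 := by
    simp [Finset.sum_add_distrib, Finsupp.single_apply]
  rw [omega1, MvPolynomial.coeff_add, MvPolynomial.coeff_sub, MvPolynomial.coeff_pderiv,
    MvPolynomial.coeff_C_mul, MvPolynomial.coeff_C_mul, MvPolynomial.coeff_X_pow, coeff_Apoly,
    coeff_Apoly, hsum, hsum']
  rcases eq_or_ne m q with rfl | hm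
  · rcases eq_or_ne i j with rfl | hij
    · rw [← Finsupp.single_add, multinomial_univ_single, multinomial_univ_single]
      simp
      ring
    · have hne : Finsupp.single i m ≠ Finsupp.single j m := fun h =>
        hij (Finsupp.single_left_injective (by omega) h)
      rw [multinomial_univ_single_add_single_one hij, multinomial_univ_single, if_neg hne]
      simp [hij.symm]
  · have hne : Finsupp.single i q ≠ Finsupp.single j m := fun h => hm <| by
      rcases (Finsupp.single_eq_single_iff _ _ _ _).mp h with h | h <;> omega
    simp [hm, hne]
end
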